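/- Let Ω ⊂ ℝ^d be a nonempty bounded open set, let E be a dyadic function on Ω that is positive and regular, let x ∈ Ω and H ∈ ℝ. If for every r > 0 the set {y ∈ B(x,r) ∩ Ω : h_E(y) = H} is nonempty, then for every p ∈ ℝ, d_E(x,H) ≤ H·p − τ_E(x,p); consequently d_E(x,H) ≤ inf_{p∈ℝ}(H·p − τ_E(x,p)) (the local multifractal formalism upper bound). -/

import Mathlib

open MeasureTheory Filter Metric Set
open scoped ENNReal Topology

noncomputable section

/-- The dyadic cube of scale `j` with index `k`:
`λ = ∏_i [k_i 2^{-j}, (k_i+1) 2^{-j})`. -/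
def dyadicCube (d : ℕ) (j : ℕ) (k : Fin d → ℤ) : Set (Fin d → ℝ) :=
  {y | ∀ i, (k i : ℝ) * 2 ^ (-(j : ℤ)) ≤ y i ∧ y i < ((k i : ℝ) + 1) * 2 ^ (-(j : ℤ))}

/-- The index of the unique dyadic cube of scale `j` containing `x`. -/
def dyadicIndex (d : ℕ) (j : ℕ) (x : Fin d → ℝ) : Fin d → ℤ :=
  fun i => ⌊x i * 2 ^ (j : ℕ)⌋

/-- The lower exponent of a dyadic function `e` at `x`:
`h_E(x) = liminf_{j→∞} log e_{λ_j(x)} / log 2^{-j}`, taken in `[-∞,∞]` with the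
convention `log 0 = -∞` (so that the quotient by the negative quantity `log 2^{-j}`
is `+∞` when `e_{λ_j(x)} = 0`). -/
def lowerExp {d : ℕ} (e : ℕ → (Fin d → ℤ) → ℝ) (x : Fin d → ℝ) : EReal :=
  Filter.liminf
    (fun j : ℕ =>
      if e j (dyadicIndex d j x) = 0 then (⊤ : EReal)
      else ((Real.log (e j (dyadicIndex d j x)) / Real.log ((2 : ℝ) ^ (-(j : ℤ))) : ℝ) : EReal))
    Filter.atTop

/-- The structure function `S_j(ω,p) = Σ_{λ ⊆ ω, ⟨λ⟩ = j} (e_λ)^p` of a dyadic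
function `e` on `ω` (a finite sum when `ω` is bounded). -/
def structFn {d : ℕ} (e : ℕ → (Fin d → ℤ) → ℝ) (ω : Set (Fin d → ℝ)) (j : ℕ) (p : ℝ) : ℝ :=
  ∑ᶠ k ∈ {k : Fin d → ℤ | dyadicCube d j k ⊆ ω}, e j k ^ p

/-- The scaling function `τ_E^ω(p) = liminf_{j→∞} log S_j(ω,p) / log 2^{-j}`. -/
def scalingFn {d : ℕ} (e : ℕ → (Fin d → ℤ) → ℝ) (ω : Set (Fin d → ℝ)) (p : ℝ) : ℝ :=
  Filter.liminf
    (fun j : ℕ => Real.log (structFn e ω j p) / Real.log ((2 : ℝ) ^ (-(j : ℤ))))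
    Filter.atTop

/-- The local scaling function `τ_E(x,p) = lim_{r→0⁺} τ_E^{B(x,r)∩Ω}(p)`; since
`r ↦ τ_E^{B(x,r)∩Ω}(p)` is nonincreasing in `r`, the limit equals the supremum
over `r > 0`. -/
def locScalingFn {d : ℕ} (e : ℕ → (Fin d → ℤ) → ℝ) (Ω : Set (Fin d → ℝ))
    (x : Fin d → ℝ) (p : ℝ) : ℝ :=
  ⨆ r : {r : ℝ // 0 < r}, scalingFn e (Metric.ball x r.1 ∩ Ω) p

/-- The local multifractal spectrum
`d_E(x,H) = lim_{r→0⁺} dim_H {y ∈ B(x,r) ∩ Ω : h_E(y) = H}`; since the spectrum on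
`B(x,r) ∩ Ω` is nondecreasing in `r`, the limit equals the infimum over `r > 0`. -/
def locSpectrum {d : ℕ} (e : ℕ → (Fin d → ℤ) → ℝ) (Ω : Set (Fin d → ℝ))
    (x : Fin d → ℝ) (H : ℝ) : ℝ≥0∞ :=
  ⨅ (r : ℝ) (_ : 0 < r),
    dimH {y ∈ Metric.ball x r ∩ Ω | lowerExp e y = (H : EReal)}

/-- The dyadic function `e` is positive and regular on `Ω`: every `e_λ` with `λ ⊆ Ω`
is positive, and `C₁ 2^{-Bj} ≤ e_λ ≤ C₂ 2^{-Aj}` for all dyadic `λ ⊆ Ω` of scale `j`. -/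
def PositiveRegular {d : ℕ} (e : ℕ → (Fin d → ℤ) → ℝ) (Ω : Set (Fin d → ℝ)) : Prop :=
  (∀ j k, dyadicCube d j k ⊆ Ω → 0 < e j k) ∧
  ∃ C₁ C₂ A B : ℝ, 0 < C₁ ∧ 0 < C₂ ∧
    ∀ j k, dyadicCube d j k ⊆ Ω →
      C₁ * 2 ^ (-(B * j)) ≤ e j k ∧ e j k ≤ C₂ * 2 ^ (-(A * j))

theorem mem_dyadicCube_dyadicIndex {d : ℕ} (j : ℕ) (y : Fin d → ℝ) :
    y ∈ dyadicCube d j (dyadicIndex d j y) := by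
  intro i
  have h2 : (0 : ℝ) < 2 ^ j := by positivity
  rw [zpow_neg, zpow_natCast, ← div_eq_mul_inv, ← div_eq_mul_inv, div_le_iff₀ h2, lt_div_iff₀ h2]
  exact ⟨Int.floor_le _, Int.lt_floor_add_one _⟩

theorem dist_le_of_mem_dyadicCube {d j : ℕ} {k : Fin d → ℤ} {y z : Fin d → ℝ}
    (hy : y ∈ dyadicCube d j k) (hz : z ∈ dyadicCube d j k) :
    dist y z ≤ ((2 : ℝ) ^ j)⁻¹ := by
  rw [dist_pi_le_iff (by positivity)]
  intro i
  have h1 := hy i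
  have h2 := hz i
  rw [zpow_neg, zpow_natCast] at h1 h2
  rw [Real.dist_eq, abs_le]
  constructor <;> nlinarith

theorem ediam_dyadicCube_le {d j : ℕ} (k : Fin d → ℤ) :
    ediam (dyadicCube d j k) ≤ ENNReal.ofReal (((2 : ℝ) ^ j)⁻¹) := by
  refine Metric.ediam_le fun y hy z hz => ?_
  rw [edist_dist]
  exact ENNReal.ofReal_le_ofReal (dist_le_of_mem_dyadicCube hy hz)

theorem tendsto_inv_two_pow : Tendsto (fun j : ℕ => ((2 : ℝ) ^ j)⁻¹) atTop (𝓝 0) := by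
  simpa using tendsto_pow_atTop_nhds_zero_of_lt_one (r := (2⁻¹ : ℝ)) (by norm_num) (by norm_num)

theorem eventually_dyadicCube_subset {d : ℕ} {ω : Set (Fin d → ℝ)} (hω : IsOpen ω)
    {y : Fin d → ℝ} (hy : y ∈ ω) :
    ∀ᶠ j in atTop, dyadicCube d j (dyadicIndex d j y) ⊆ ω := by
  obtain ⟨ε, hε, hball⟩ := Metric.isOpen_iff.1 hω y hy
  filter_upwards [tendsto_inv_two_pow.eventually_lt_const hε] with j hj z hz
  exact hball ((dist_le_of_mem_dyadicCube hz (mem_dyadicCube_dyadicIndex j y)).trans_lt hj)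

/-- The number of dyadic cubes of scale `j` inside a bounded set is at most `C * 2 ^ (d * j)`. -/
theorem exists_card_dyadicCube_subset_le {d : ℕ} {ω : Set (Fin d → ℝ)}
    (hω : Bornology.IsBounded ω) :
    ∃ C : ℝ, 1 ≤ C ∧ ∀ j : ℕ, ∃ K : Finset (Fin d → ℤ),
      (∀ k, dyadicCube d j k ⊆ ω → k ∈ K) ∧ (K.card : ℝ) ≤ C * (2 ^ j) ^ d := by
  obtain ⟨R, hR0, hR⟩ := hω.subset_closedBall_lt 0 0
  refine ⟨(2 * R + 3) ^ d, one_le_pow₀ (by linarith), fun j => ?_⟩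
  have h2 : (0 : ℝ) < 2 ^ j := by positivity
  have h2' : (1 : ℝ) ≤ 2 ^ j := one_le_pow₀ (by norm_num)
  set N : ℤ := ⌈R * 2 ^ j⌉ with hN
  have hN0 : 0 ≤ N := Int.ceil_nonneg (by positivity)
  refine ⟨Finset.Icc (fun _ => -N) (fun _ => N), fun k hk => ?_, ?_⟩
  · have hmem : (fun i => (k i : ℝ) * (2 ^ j)⁻¹) ∈ dyadicCube d j k := by
      intro i
      rw [zpow_neg, zpow_natCast]
      exact ⟨le_rfl, mul_lt_mul_of_pos_right (by linarith) (inv_pos.2 h2)⟩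
    have hnorm := hR (hk hmem)
    rw [mem_closedBall_zero_iff, pi_norm_le_iff_of_nonneg hR0.le] at hnorm
    have key : ∀ i, |k i| ≤ N := by
      intro i
      have h := hnorm i
      rw [Real.norm_eq_abs, abs_mul, abs_of_pos (inv_pos.2 h2), ← div_eq_mul_inv,
        div_le_iff₀ h2] at h
      have : ((|k i| : ℤ) : ℝ) ≤ (N : ℝ) := by
        push_cast
        exact h.trans (Int.le_ceil _)
      exact_mod_cast this
    rw [Finset.mem_Icc]
    exact ⟨fun i => (abs_le.1 (key i)).1, fun i => (abs_le.1 (key i)).2⟩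
  · rw [Pi.card_Icc]
    simp only [Int.card_Icc, Finset.prod_const, Finset.card_univ, Fintype.card_fin]
    push_cast
    rw [← mul_pow]
    refine pow_le_pow_left₀ (by positivity) ?_ d
    have hc : (((N + 1 - -N).toNat : ℤ) : ℝ) = 2 * N + 1 := by
      rw [Int.toNat_of_nonneg (by omega)]
      push_cast
      ring
    rw [Int.cast_natCast] at hc
    rw [hc]
    have := (Int.ceil_lt_add_one (R * 2 ^ j)).le
    rw [← hN] at this
    nlinarith

/-- If every point of `F` lies in infinitely many of the cubes selected by `G`, and `G` selects at
most `2 ^ ((s - η) * j)` cubes of scale `j`, then `F` has Hausdorff dimension at most `s`. -/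
theorem dimH_le_of_frequently_mem_dyadicIndex {d : ℕ} {F : Set (Fin d → ℝ)}
    {G : ℕ → Finset (Fin d → ℤ)} {s η : ℝ} (hs : 0 ≤ s) (hη : 0 < η)
    (hcard : ∀ᶠ j : ℕ in atTop, ((G j).card : ℝ) ≤ 2 ^ ((s - η) * j))
    (hF : ∀ y ∈ F, ∃ᶠ j in atTop, dyadicIndex d j y ∈ G j) :
    dimH F ≤ ENNReal.ofReal s := by
  set q : ℝ≥0∞ := ENNReal.ofReal (2 ^ (-η)) with hq
  have hq1 : q < 1 := by
    rw [hq, ENNReal.ofReal_lt_one]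
    exact Real.rpow_lt_one_of_one_lt_of_neg (by norm_num) (by linarith)
  have hterm : ∀ j : ℕ, ((G j).card : ℝ) ≤ 2 ^ ((s - η) * j) →
      ((G j).card : ℝ≥0∞) * ENNReal.ofReal (((2 : ℝ) ^ j)⁻¹) ^ s ≤ q ^ j := by
    intro j hj
    rw [hq, ← ENNReal.ofReal_pow (by positivity), ENNReal.ofReal_rpow_of_nonneg (by positivity) hs,
      ← ENNReal.ofReal_natCast, ← ENNReal.ofReal_mul (by positivity)]
    refine ENNReal.ofReal_le_ofReal ?_
    have h1 : (((2 : ℝ) ^ j)⁻¹) ^ s = 2 ^ (-(s * j)) := by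
      rw [← Real.rpow_natCast, ← Real.rpow_neg (by norm_num), ← Real.rpow_mul (by norm_num)]
      congr 1
      ring
    rw [h1, ← Real.rpow_mul_natCast (by norm_num)]
    calc ((G j).card : ℝ) * 2 ^ (-(s * j)) ≤ 2 ^ ((s - η) * j) * 2 ^ (-(s * j)) := by gcongr
      _ = 2 ^ (-η * j) := by
        rw [← Real.rpow_add (by norm_num)]
        congr 1
        ring
  have hmeas : Measure.hausdorffMeasure s F ≤ (1 - q)⁻¹ := by
    refine (Measure.hausdorffMeasure_le_liminf_tsum (ι := fun n : ℕ => Σ i : ℕ, G (i + n)) s F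
      (l := atTop) (fun n => ENNReal.ofReal (((2 : ℝ) ^ n)⁻¹)) ?_
      (fun n p => dyadicCube d (p.1 + n) p.2) (Eventually.of_forall fun n p => ?_)
      (Eventually.of_forall fun n y hy => ?_)).trans ?_
    · simpa using ENNReal.tendsto_ofReal tendsto_inv_two_pow
    · refine (ediam_dyadicCube_le _).trans (ENNReal.ofReal_le_ofReal ?_)
      gcongr
      · norm_num
      · omega
    · obtain ⟨j, hj, hmem⟩ := frequently_atTop.1 (hF y hy) n
      obtain ⟨i, rfl⟩ := Nat.exists_eq_add_of_le' hj
      exact mem_iUnion.2 ⟨⟨i, _, hmem⟩, mem_dyadicCube_dyadicIndex _ _⟩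
    · refine liminf_le_of_frequently_le' (Eventually.frequently ?_)
      filter_upwards [eventually_forall_ge_atTop.2 hcard] with n hn
      rw [ENNReal.tsum_sigma', ← ENNReal.tsum_geometric]
      refine le_trans (ENNReal.tsum_le_tsum fun i => ?_)
        (ENNReal.tsum_comp_le_tsum_of_injective (add_left_injective n) fun j => q ^ j)
      refine le_trans ?_ (hterm (i + n) (hn _ (by omega)))
      rw [tsum_fintype]
      refine (Finset.sum_le_card_nsmul _ _ _ fun k _ =>
        ENNReal.rpow_le_rpow (ediam_dyadicCube_le (j := i + n) k.1) hs).trans ?_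
      simp [nsmul_eq_mul]
  have hne : Measure.hausdorffMeasure (s.toNNReal : ℝ) F ≠ ∞ := by
    rw [Real.coe_toNNReal s hs]
    refine (hmeas.trans_lt ?_).ne
    rw [ENNReal.inv_lt_top]
    exact tsub_pos_of_lt hq1
  exact dimH_le_of_hausdorffMeasure_ne_top hne

theorem structFn_eq_sum {d : ℕ} (e : ℕ → (Fin d → ℤ) → ℝ) {ω : Set (Fin d → ℝ)} {j : ℕ} (p : ℝ)
    (hfin : {k : Fin d → ℤ | dyadicCube d j k ⊆ ω}.Finite) :
    structFn e ω j p = ∑ k ∈ hfin.toFinset, e j k ^ p :=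
  finsum_mem_eq_finite_toFinset_sum _ hfin

theorem finite_setOf_dyadicCube_subset {d : ℕ} {ω : Set (Fin d → ℝ)}
    (hω : Bornology.IsBounded ω) (j : ℕ) : {k : Fin d → ℤ | dyadicCube d j k ⊆ ω}.Finite := by
  obtain ⟨C, -, hC⟩ := exists_card_dyadicCube_subset_le hω
  obtain ⟨K, hK, -⟩ := hC j
  exact K.finite_toSet.subset hK

/-- The powers of a positive regular dyadic function grow at most exponentially in the scale. -/
theorem PositiveRegular.exists_rpow_le {d : ℕ} {e : ℕ → (Fin d → ℤ) → ℝ} {Ω : Set (Fin d → ℝ)}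
    (h : PositiveRegular e Ω) (p : ℝ) :
    ∃ a b : ℝ, 0 ≤ a ∧ 0 ≤ b ∧
      ∀ j k, dyadicCube d j k ⊆ Ω → e j k ^ p ≤ Real.exp (a + b * j) := by
  obtain ⟨hpos, C₁, C₂, A, B, hC₁, hC₂, hb⟩ := h
  refine ⟨|p| * (|Real.log C₁| + |Real.log C₂|), |p| * ((|A| + |B|) * Real.log 2),
    by positivity, by positivity, fun j k hk => ?_⟩
  have he := hpos j k hk
  obtain ⟨h1, h2⟩ := hb j k hk
  have hl2 : 0 < Real.log 2 := Real.log_pos (by norm_num)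
  have l1 := Real.log_le_log (by positivity) h1
  have l2 := Real.log_le_log he h2
  rw [Real.log_mul (by positivity) (by positivity), Real.log_rpow (by norm_num)] at l1 l2
  have hA : |A * j * Real.log 2| = |A| * Real.log 2 * j := by
    rw [abs_mul, abs_mul, abs_of_pos hl2, Nat.abs_cast]; ring
  have hB : |B * j * Real.log 2| = |B| * Real.log 2 * j := by
    rw [abs_mul, abs_mul, abs_of_pos hl2, Nat.abs_cast]; ring
  have habs : |Real.log (e j k)| ≤
      |Real.log C₁| + |Real.log C₂| + (|A| + |B|) * Real.log 2 * j := by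
    rw [abs_le]
    constructor
    · linarith [neg_abs_le (Real.log C₁), le_abs_self (B * j * Real.log 2),
        abs_nonneg (Real.log C₂), abs_nonneg (A * j * Real.log 2)]
    · linarith [le_abs_self (Real.log C₂), neg_abs_le (A * j * Real.log 2),
        abs_nonneg (Real.log C₁), abs_nonneg (B * j * Real.log 2)]
  rw [Real.rpow_def_of_pos he]
  refine Real.exp_le_exp.2 ?_
  calc Real.log (e j k) * p ≤ |Real.log (e j k) * p| := le_abs_self _
    _ = |p| * |Real.log (e j k)| := by rw [abs_mul, mul_comm]
    _ ≤ |p| * (|Real.log C₁| + |Real.log C₂| + (|A| + |B|) * Real.log 2 * j) := by gcongr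
    _ = _ := by ring

theorem log_two_zpow_neg (j : ℕ) : Real.log ((2 : ℝ) ^ (-(j : ℤ))) = -(j * Real.log 2) := by
  rw [Real.log_zpow]
  push_cast
  ring

theorem isBoundedUnder_log_structFn {d : ℕ} {e : ℕ → (Fin d → ℤ) → ℝ} {Ω ω : Set (Fin d → ℝ)}
    (hreg : PositiveRegular e Ω) (hωΩ : ω ⊆ Ω) (hω : Bornology.IsBounded ω) (p : ℝ) :
    IsBoundedUnder (· ≥ ·) atTop
      fun j : ℕ => Real.log (structFn e ω j p) / Real.log ((2 : ℝ) ^ (-(j : ℤ))) := by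
  obtain ⟨C, hC1, hC⟩ := exists_card_dyadicCube_subset_le hω
  obtain ⟨a, b, ha, hb, hab⟩ := hreg.exists_rpow_le p
  have hl2 : 0 < Real.log 2 := Real.log_pos (by norm_num)
  have hlC : 0 ≤ Real.log C := Real.log_nonneg hC1
  set M := Real.log C + d * Real.log 2 + a + b with hM
  have hM0 : 0 ≤ M := by positivity
  refine ⟨-(M / Real.log 2), ?_⟩
  rw [eventually_map]
  filter_upwards [eventually_ge_atTop 1] with j hj
  have hj' : (1 : ℝ) ≤ j := by exact_mod_cast hj
  have hfin := finite_setOf_dyadicCube_subset hω j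
  obtain ⟨K, hK, hKcard⟩ := hC j
  have hS0 : 0 ≤ structFn e ω j p := by
    rw [structFn_eq_sum e p hfin]
    exact Finset.sum_nonneg fun k hk =>
      (Real.rpow_pos_of_pos (hreg.1 j k ((hfin.mem_toFinset.1 hk).trans hωΩ)) p).le
  have hS : structFn e ω j p ≤ C * (2 ^ j) ^ d * Real.exp (a + b * j) := by
    rw [structFn_eq_sum e p hfin]
    refine (Finset.sum_le_card_nsmul _ _ _ fun k hk =>
      hab j k ((hfin.mem_toFinset.1 hk).trans hωΩ)).trans ?_
    rw [nsmul_eq_mul]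
    gcongr
    refine le_trans ?_ hKcard
    exact_mod_cast Finset.card_le_card fun k hk => hK k (hfin.mem_toFinset.1 hk)
  have hlog : Real.log (structFn e ω j p) ≤ M * j := by
    rcases hS0.eq_or_lt with h0 | h0
    · rw [← h0, Real.log_zero]
      positivity
    · refine (Real.log_le_log h0 hS).trans ?_
      rw [Real.log_mul (by positivity) (by positivity), Real.log_mul (by positivity)
        (by positivity), Real.log_exp, ← pow_mul, Real.log_pow]
      push_cast
      have := mul_nonneg hlC (sub_nonneg.2 hj')
      have := mul_nonneg ha (sub_nonneg.2 hj')
      rw [hM]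
      nlinarith
  rw [log_two_zpow_neg, div_neg, ge_iff_le, neg_le_neg_iff, div_le_div_iff₀ (by positivity) hl2]
  nlinarith

/-- At a point of exponent `H`, the `p`-th powers of the values of the dyadic function on the cubes
around the point are infinitely often bounded below by `2 ^ (-(H * p + ε) * j)`. -/
theorem frequently_le_rpow_of_lowerExp_eq {d : ℕ} {e : ℕ → (Fin d → ℤ) → ℝ}
    {ω : Set (Fin d → ℝ)} (hω : IsOpen ω)
    (hpos : ∀ j k, dyadicCube d j k ⊆ ω → 0 < e j k) {y : Fin d → ℝ} (hy : y ∈ ω) {H : ℝ}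
    (hH : lowerExp e y = H) (p : ℝ) {ε : ℝ} (hε : 0 < ε) :
    ∃ᶠ j : ℕ in atTop, dyadicCube d j (dyadicIndex d j y) ⊆ ω ∧
      (2 : ℝ) ^ (-(H * p + ε) * j) ≤ e j (dyadicIndex d j y) ^ p := by
  have hl2 : 0 < Real.log 2 := Real.log_pos (by norm_num)
  obtain ⟨δ, hδ, hδε⟩ : ∃ δ : ℝ, 0 < δ ∧ |p| * δ ≤ ε := by
    refine ⟨ε / (|p| + 1), by positivity, ?_⟩
    rw [mul_div_assoc', div_le_iff₀ (by positivity)]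
    nlinarith [abs_nonneg p]
  have hlt : lowerExp e y < ((H + δ : ℝ) : EReal) := by
    rw [hH]
    exact_mod_cast (by linarith : H < H + δ)
  have hgt : ((H - δ : ℝ) : EReal) < lowerExp e y := by
    rw [hH]
    exact_mod_cast (by linarith : H - δ < H)
  refine ((((frequently_lt_of_liminf_lt (by isBoundedDefault) hlt).and_eventually
    (eventually_lt_of_lt_liminf hgt)).and_eventually
    (eventually_dyadicCube_subset hω hy)).and_eventually (eventually_ge_atTop 1)).mono ?_
  rintro j ⟨⟨⟨h1, h2⟩, hsub⟩, hj⟩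
  refine ⟨hsub, ?_⟩
  have he := hpos j _ hsub
  have hj0 : (0 : ℝ) < j := by exact_mod_cast hj
  simp only [he.ne', if_false] at h1 h2
  rw [EReal.coe_lt_coe_iff, log_two_zpow_neg] at h1 h2
  set v := Real.log (e j (dyadicIndex d j y)) / -(j * Real.log 2) with hv
  have hlog : Real.log (e j (dyadicIndex d j y)) = -(v * (j * Real.log 2)) := by
    rw [hv]
    field_simp
  have hvp : v * p ≤ H * p + ε := by
    have h3 : |v - H| ≤ δ := abs_le.2 ⟨by linarith, by linarith⟩
    have h4 : (v - H) * p ≤ |p| * δ := by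
      refine (le_abs_self _).trans ?_
      rw [abs_mul, mul_comm]
      gcongr
    linarith
  rw [Real.rpow_def_of_pos he, Real.rpow_def_of_pos (by norm_num : (0 : ℝ) < 2), hlog]
  refine Real.exp_le_exp.2 ?_
  have := mul_le_mul_of_nonneg_right hvp (by positivity : 0 ≤ j * Real.log 2)
  nlinarith

theorem eventually_structFn_le {d : ℕ} {e : ℕ → (Fin d → ℤ) → ℝ} {Ω ω : Set (Fin d → ℝ)}
    (hreg : PositiveRegular e Ω) (hωΩ : ω ⊆ Ω) (hω : Bornology.IsBounded ω) {p t : ℝ}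
    (ht : t < scalingFn e ω p) :
    ∀ᶠ j : ℕ in atTop, structFn e ω j p ≤ 2 ^ (-t * j) := by
  have hl2 : 0 < Real.log 2 := Real.log_pos (by norm_num)
  filter_upwards [eventually_lt_of_lt_liminf ht (isBoundedUnder_log_structFn hreg hωΩ hω p),
    eventually_ge_atTop 1] with j h hj
  have hj0 : (0 : ℝ) < j := by exact_mod_cast hj
  rcases le_or_gt (structFn e ω j p) 0 with h0 | h0
  · exact h0.trans (by positivity)
  rw [log_two_zpow_neg, div_neg, lt_neg, div_lt_iff₀ (by positivity)] at h
  rw [← Real.log_le_log_iff h0 (by positivity), Real.log_rpow (by norm_num)]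
  linarith

/-- The upper bound for the spectrum on an open set, together with the nonnegativity of the
right-hand side. -/
theorem dimH_level_le {d : ℕ} {e : ℕ → (Fin d → ℤ) → ℝ} {Ω ω : Set (Fin d → ℝ)}
    (hreg : PositiveRegular e Ω) (hωΩ : ω ⊆ Ω) (hωb : Bornology.IsBounded ω) (hωo : IsOpen ω)
    {H : ℝ} (hne : {y ∈ ω | lowerExp e y = (H : EReal)}.Nonempty) (p : ℝ) :
    0 ≤ H * p - scalingFn e ω p ∧
      dimH {y ∈ ω | lowerExp e y = (H : EReal)} ≤ ENNReal.ofReal (H * p - scalingFn e ω p) := by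
  set F := {y ∈ ω | lowerExp e y = (H : EReal)} with hF
  set s₀ := H * p - scalingFn e ω p with hs₀
  have hpos : ∀ j k, dyadicCube d j k ⊆ ω → 0 < e j k := fun j k hk => hreg.1 j k (hk.trans hωΩ)
  have key : ∀ s, s₀ < s → ∃ η > 0, ∃ G : ℕ → Finset (Fin d → ℤ),
      (∀ᶠ j : ℕ in atTop, ((G j).card : ℝ) ≤ 2 ^ ((s - η) * j)) ∧
      ∀ y ∈ F, ∃ᶠ j in atTop, dyadicIndex d j y ∈ G j := by
    intro s hs
    set η := (s - s₀) / 3 with hη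
    have hη0 : 0 < η := by linarith
    refine ⟨η, hη0, fun j => (finite_setOf_dyadicCube_subset hωb j).toFinset.filter
      fun k => (2 : ℝ) ^ (-(H * p + η) * j) ≤ e j k ^ p, ?_, fun y hy => ?_⟩
    · filter_upwards [eventually_structFn_le hreg hωΩ hωb
        (by linarith : scalingFn e ω p - η < scalingFn e ω p)] with j hj
      have hfin := finite_setOf_dyadicCube_subset hωb j
      rw [structFn_eq_sum e p hfin] at hj
      set G := hfin.toFinset.filter fun k => (2 : ℝ) ^ (-(H * p + η) * j) ≤ e j k ^ p with hG
      have h1 : (G.card : ℝ) * 2 ^ (-(H * p + η) * j) ≤ 2 ^ (-(scalingFn e ω p - η) * j) := by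
        rw [← nsmul_eq_mul]
        refine (Finset.card_nsmul_le_sum G (fun k => e j k ^ p) _ fun k hk =>
          (Finset.mem_filter.1 hk).2).trans (le_trans ?_ hj)
        exact Finset.sum_le_sum_of_subset_of_nonneg (Finset.filter_subset _ _) fun k hk _ =>
          (Real.rpow_pos_of_pos (hpos j k (hfin.mem_toFinset.1 hk)) p).le
      rw [← le_div_iff₀ (by positivity), ← Real.rpow_sub (by norm_num)] at h1
      refine h1.trans_eq ?_
      congr 1
      rw [hη, hs₀]
      ring
    · refine (frequently_le_rpow_of_lowerExp_eq hωo hpos hy.1 hy.2 p hη0).mono fun j hj => ?_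
      simpa using hj
  have hs₀0 : 0 ≤ s₀ := by
    by_contra! hneg
    obtain ⟨η, hη, G, hG, hFG⟩ := key 0 hneg
    obtain ⟨y, hy⟩ := hne
    obtain ⟨j, ⟨hmem, hcard⟩, hj⟩ :=
      (((hFG y hy).and_eventually hG).and_eventually (eventually_ge_atTop 1)).exists
    have hj0 : (0 : ℝ) < j := by exact_mod_cast hj
    have h1 : (2 : ℝ) ^ ((0 - η) * j) < 1 :=
      Real.rpow_lt_one_of_one_lt_of_neg (by norm_num) (by nlinarith)
    have h2 : (1 : ℝ) ≤ (G j).card := by exact_mod_cast Finset.card_pos.2 ⟨_, hmem⟩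
    linarith
  refine ⟨hs₀0, ?_⟩
  refine ge_of_tendsto (ENNReal.continuous_ofReal.continuousWithinAt (s := Ioi s₀)).tendsto ?_
  filter_upwards [self_mem_nhdsWithin] with s hs
  obtain ⟨η, hη, G, hG, hFG⟩ := key s hs
  exact dimH_le_of_frequently_mem_dyadicIndex (hs₀0.trans hs.le) hη hG hFG

/-- The local multifractal formalism upper bound: if `Ω` is a nonempty bounded open
set, `E` is a positive regular dyadic function on `Ω`, `x ∈ Ω`, `H ∈ ℝ`, and for
every `r > 0` the level set `{y ∈ B(x,r) ∩ Ω : h_E(y) = H}` is nonempty, then for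
every `p ∈ ℝ`, `d_E(x,H) ≤ H p − τ_E(x,p)`, and consequently
`d_E(x,H) ≤ inf_{p∈ℝ} (H p − τ_E(x,p))`. -/
theorem locSpectrum_le_local_legendre {d : ℕ} (Ω : Set (Fin d → ℝ))
    (hΩo : IsOpen Ω) (hΩne : Ω.Nonempty) (hΩb : Bornology.IsBounded Ω)
    (e : ℕ → (Fin d → ℤ) → ℝ) (hreg : PositiveRegular e Ω)
    (x : Fin d → ℝ) (hx : x ∈ Ω) (H : ℝ)
    (hne : ∀ r : ℝ, 0 < r →
      {y ∈ Metric.ball x r ∩ Ω | lowerExp e y = (H : EReal)}.Nonempty) :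
    (∀ p : ℝ,
        (locSpectrum e Ω x H : EReal) ≤ ((H * p - locScalingFn e Ω x p : ℝ) : EReal)) ∧
      (locSpectrum e Ω x H : EReal)
        ≤ ⨅ p : ℝ, ((H * p - locScalingFn e Ω x p : ℝ) : EReal) := by
  have main : ∀ p : ℝ,
      (locSpectrum e Ω x H : EReal) ≤ ((H * p - locScalingFn e Ω x p : ℝ) : EReal) := by
    intro p
    have hr : ∀ r : {r : ℝ // 0 < r}, 0 ≤ H * p - scalingFn e (ball x r.1 ∩ Ω) p ∧
        locSpectrum e Ω x H ≤ ENNReal.ofReal (H * p - scalingFn e (ball x r.1 ∩ Ω) p) := by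
      intro r
      obtain ⟨h1, h2⟩ := dimH_level_le hreg inter_subset_right (hΩb.subset inter_subset_right)
        (isOpen_ball.inter hΩo) (hne r.1 r.2) p
      exact ⟨h1, (iInf₂_le r.1 r.2).trans h2⟩
    have hfin : locSpectrum e Ω x H ≠ ∞ :=
      ne_top_of_le_ne_top ENNReal.ofReal_ne_top (hr ⟨1, one_pos⟩).2
    have : Nonempty {r : ℝ // 0 < r} := ⟨⟨1, one_pos⟩⟩
    have hsup : locScalingFn e Ω x p ≤ H * p - (locSpectrum e Ω x H).toReal :=
      ciSup_le fun r => by linarith [ENNReal.toReal_le_of_le_ofReal (hr r).1 (hr r).2]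
    rw [← EReal.coe_ennreal_toReal hfin, EReal.coe_le_coe_iff]
    linarith
  exact ⟨main, le_iInf main⟩

end
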